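/- For integers k ≥ 4 and n ≥ k, every connected graph G of order n with rvd(G) = k satisfies |E(G)| ≤ k(n−1) − k(k−1)/2; moreover, there exists a connected graph G of order n with rvd(G) = k and |E(G)| ≥ k(n−1)/2 − k(k−1)/2. -/

import Mathlib

open SimpleGraph

/-- A set of vertices is rainbow under a coloring `c` if no two of its vertices
receive the same color. -/
def RainbowSet {V : Type*} (c : V → ℕ) (S : Set V) : Prop := Set.InjOn c S

/-- `c` is a rainbow vertex-disconnection coloring of `G`: for every two distinct
vertices `x, y` there is a set `S` avoiding `x` and `y` such that every `x`-`y` walk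
in `G - xy` (which is `G` itself when `x, y` are nonadjacent) meets `S` (i.e. `S` is
an `x`-`y` vertex-cut), and moreover `S` is rainbow when `x, y` are nonadjacent,
while `S ∪ {x}` or `S ∪ {y}` is rainbow when `x, y` are adjacent. -/
def IsRVDColoring {V : Type*} (G : SimpleGraph V) (c : V → ℕ) : Prop :=
  ∀ x y : V, x ≠ y → ∃ S : Set V, x ∉ S ∧ y ∉ S ∧
    (∀ p : (G.deleteEdges {s(x, y)}).Walk x y, ∃ v ∈ p.support, v ∈ S) ∧
    (¬ G.Adj x y → RainbowSet c S) ∧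
    (G.Adj x y → (RainbowSet c (insert x S) ∨ RainbowSet c (insert y S)))

/-- The rainbow vertex-disconnection number `rvd G`: the minimum number of colors
used by a rainbow vertex-disconnection coloring of `G`. -/
noncomputable def rvd {V : Type*} (G : SimpleGraph V) : ℕ :=
  sInf {k | ∃ c : V → ℕ, IsRVDColoring G c ∧ (Set.range c).ncard = k}

/-- The number of neighbours of `u` in the finite set `T`. -/
noncomputable def degIn {V : Type*} (G : SimpleGraph V) (T : Finset V) (u : V) : ℕ :=
  open Classical in (T.filter (fun w => G.Adj u w)).card

open Classical in
theorem degIn_insert {V : Type*} (G : SimpleGraph V) {T : Finset V} {v : V} (hv : v ∉ T) (u : V) :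
    degIn G (insert v T) u = degIn G T u + if G.Adj u v then 1 else 0 := by
  unfold degIn
  rw [Finset.filter_insert]
  split_ifs with h
  · rw [Finset.card_insert_of_notMem (by simp [hv])]
  · rfl

theorem degIn_empty {V : Type*} (G : SimpleGraph V) (u : V) : degIn G ∅ u = 0 := by
  simp [degIn]

open Classical in
/-- The initial segments of the maximum adjacency orderings of the vertices in `W`. -/
inductive MaxAdjPrefix {V : Type*} (G : SimpleGraph V) (W : Finset V) : Finset V → Prop
  | empty : MaxAdjPrefix G W ∅
  | step {T : Finset V} {v : V} : MaxAdjPrefix G W T → v ∈ W → v ∉ T →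
      (∀ u ∈ W, u ∉ T → degIn G T u ≤ degIn G T v) → MaxAdjPrefix G W (insert v T)

theorem exists_maxAdjPrefix_card {V : Type*} (G : SimpleGraph V) (W : Finset V) (j : ℕ)
    (hj : j ≤ W.card) : ∃ T, MaxAdjPrefix G W T ∧ T ⊆ W ∧ T.card = j := by
  classical
  induction j with
  | zero => exact ⟨∅, .empty, by simp, rfl⟩
  | succ j ih =>
    obtain ⟨T, hT, hTW, hc⟩ := ih (by omega)
    have hne : (W \ T).Nonempty := by
      rw [← Finset.card_pos, Finset.card_sdiff_of_subset hTW]; omega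
    obtain ⟨v, hv, hmax⟩ := Finset.exists_max_image (W \ T) (degIn G T) hne
    rw [Finset.mem_sdiff] at hv
    refine ⟨insert v T, ?_, Finset.insert_subset hv.1 hTW, ?_⟩
    · convert MaxAdjPrefix.step hT hv.1 hv.2 fun u hu hu' =>
        hmax u (Finset.mem_sdiff.2 ⟨hu, hu'⟩)
    · rw [Finset.card_insert_of_notMem hv.2, hc]

/-- The prefix at which the last neighbour `x` of `y` is about to be added. -/
theorem MaxAdjPrefix.exists_last_neighbor {V : Type*} {G : SimpleGraph V} {W T : Finset V}
    (hT : MaxAdjPrefix G W T) {y : V} (hy : y ∉ T) (hd : degIn G T y ≠ 0) :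
    ∃ T' x, MaxAdjPrefix G W T' ∧ x ∉ T' ∧ y ∉ T' ∧
      (∀ u ∈ W, u ∉ T' → degIn G T' u ≤ degIn G T' x) ∧ x ∈ W ∧ G.Adj y x ∧
      degIn G T y = degIn G T' y + 1 := by
  classical
  induction hT with
  | empty => simp [degIn_empty] at hd
  | @step T v hT hvW hvT hmax ih =>
    have hins : degIn G (insert v T) y = degIn G T y + if G.Adj y v then 1 else 0 :=
      degIn_insert G hvT y
    have hyT : y ∉ T := fun h => hy (by simp [h])
    by_cases hadj : G.Adj y v
    · refine ⟨T, v, hT, hvT, hyT, hmax, hvW, hadj, ?_⟩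
      convert hins using 2
      simp [hadj]
    · have hins' : degIn G (insert v T) y = degIn G T y := by simpa [hadj] using hins
      obtain ⟨T', x, h⟩ := ih hyT (by convert hd using 1; convert hins'.symm)
      refine ⟨T', x, ?_⟩
      convert h using 8

/-- If `S` separates `A` from `B` up to the edge `xy`, then at every stage of a maximum
adjacency ordering before `x` and `y`, on one of the two sides no remaining vertex has more
placed neighbours than there are placed vertices of `S`. -/
theorem MaxAdjPrefix.degIn_le_separator {V : Type*} {G : SimpleGraph V} {W T : Finset V}
    (hT : MaxAdjPrefix G W T) {A B S : Set V} {x y : V}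
    (hcover : ∀ v, v ∈ A ∨ v ∈ B ∨ v ∈ S)
    (hsep : ∀ a ∈ A, ∀ b ∈ B, G.Adj a b → a = x ∧ b = y) (hx : x ∉ T) (hy : y ∉ T) :
    open Classical in
    (∀ u ∈ W, u ∉ T → u ∈ A → degIn G T u ≤ (T.filter (· ∈ S)).card) ∨
    (∀ u ∈ W, u ∉ T → u ∈ B → degIn G T u ≤ (T.filter (· ∈ S)).card) := by
  classical
  induction hT with
  | empty => simp [degIn_empty]
  | @step T v hT hvW hvT hmax ih =>
    have hxT : x ∉ T := fun h => hx (by simp [h])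
    have hyT : y ∉ T := fun h => hy (by simp [h])
    have hxv : v ≠ x := fun h => hx (by simp [h])
    have hyv : v ≠ y := fun h => hy (by simp [h])
    have hins (u : V) : degIn G (insert v T) u = degIn G T u + if G.Adj u v then 1 else 0 :=
      degIn_insert G hvT u
    have hmono : (T.filter (· ∈ S)).card ≤ ((insert v T).filter (· ∈ S)).card :=
      Finset.card_le_card (Finset.filter_subset_filter _ (Finset.subset_insert _ _))
    specialize ih hxT hyT
    suffices h :
        (∀ u ∈ W, u ∉ insert v T → u ∈ A →
          degIn G (insert v T) u ≤ ((insert v T).filter (· ∈ S)).card) ∨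
        (∀ u ∈ W, u ∉ insert v T → u ∈ B →
          degIn G (insert v T) u ≤ ((insert v T).filter (· ∈ S)).card) by
      convert h
    rcases hcover v with hv | hv | hv
    · right
      intro u hu huT huB
      have huT' : u ∉ T := fun h => huT (by simp [h])
      have hna : ¬ G.Adj u v := fun h => hxv (hsep v hv u huB h.symm).1
      rw [hins, if_neg hna, add_zero]
      rcases ih with ih | ih
      · exact (hmax u hu huT').trans ((ih v hvW hvT hv).trans hmono)
      · exact (ih u hu huT' huB).trans hmono
    · left
      intro u hu huT huA
      have huT' : u ∉ T := fun h => huT (by simp [h])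
      have hna : ¬ G.Adj u v := fun h => hyv (hsep u huA v hv h).2
      rw [hins, if_neg hna, add_zero]
      rcases ih with ih | ih
      · exact (ih u hu huT' huA).trans hmono
      · exact (hmax u hu huT').trans ((ih v hvW hvT hv).trans hmono)
    · have hS : ((insert v T).filter (· ∈ S)).card = (T.filter (· ∈ S)).card + 1 := by
        rw [Finset.filter_insert, if_pos hv, Finset.card_insert_of_notMem (by simp [hvT])]
      have hle (u : V) : degIn G (insert v T) u ≤ degIn G T u + 1 := by
        rw [hins]; split_ifs <;> omega
      rw [hS]
      refine ih.imp (fun ih u hu huT huA => ?_) (fun ih u hu huT huA => ?_) <;>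
      · have := ih u hu (fun h => huT (by simp [h])) huA
        have := hle u
        omega

/-- A coloring that is injective on a set takes at least as many values. -/
theorem Finset.card_le_ncard_range {V : Type*} [Finite V] {c : V → ℕ} {T : Finset V}
    (h : Set.InjOn c T) : T.card ≤ (Set.range c).ncard := by
  rw [← Set.ncard_coe_finset, ← h.ncard_image]
  exact Set.ncard_le_ncard (Set.image_subset_range _ _) (Set.finite_range c)

/-- Every nonempty vertex set induces a vertex of degree at most the number of colors. -/
theorem IsRVDColoring.exists_degIn_le {V : Type*} [Finite V] {G : SimpleGraph V} {c : V → ℕ}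
    (hc : IsRVDColoring G c) {W : Finset V} (hW : W.Nonempty) :
    ∃ y ∈ W, degIn G W y ≤ (Set.range c).ncard := by
  classical
  by_contra! hdeg
  obtain ⟨T, hT, hTW, hcard⟩ := exists_maxAdjPrefix_card G W (W.card - 1) (by omega)
  have hW' := hW.card_pos
  obtain ⟨y, hy⟩ : (W \ T).Nonempty := by
    rw [← Finset.card_pos, Finset.card_sdiff_of_subset hTW]; omega
  rw [Finset.mem_sdiff] at hy
  have hWT : W = insert y T :=
    (Finset.eq_of_subset_of_card_le (Finset.insert_subset hy.1 hTW)
      (by rw [Finset.card_insert_of_notMem hy.2]; omega)).symm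
  have hdy : degIn G W y = degIn G T y := by
    rw [hWT, degIn_insert G hy.2]; simp
  have hyk := hdeg y hy.1
  obtain ⟨T', x, hT', hxT, hyT, hmax, hxW, hadj, hlast⟩ :=
    hT.exists_last_neighbor hy.2 (by omega)
  obtain ⟨S, hxS, hyS, hcut, -, hrain⟩ := hc x y hadj.ne'
  set A : Set V := {v | ∃ p : (G.deleteEdges {s(x, y)}).Walk x v, ∀ w ∈ p.support, w ∉ S} with hA
  have hxA : x ∈ A := ⟨.nil, by simpa using hxS⟩
  have hyA : y ∉ A := by
    rintro ⟨p, hp⟩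
    obtain ⟨v, hv, hvS⟩ := hcut p
    exact hp v hv hvS
  have hinv := hT'.degIn_le_separator (A := A) (B := {v | v ∉ A ∧ v ∉ S}) (S := S)
    (x := x) (y := y) (fun v => by by_cases v ∈ A <;> by_cases v ∈ S <;> simp_all)
    (by
      rintro a ⟨p, hp⟩ b ⟨hbA, hbS⟩ hab
      by_cases he : s(a, b) = s(x, y)
      · rcases Sym2.eq_iff.1 he with h | ⟨-, h⟩
        · exact h
        · exact absurd (h ▸ hxA) hbA
      · have hab' : (G.deleteEdges {s(x, y)}).Adj a b := by
          rw [SimpleGraph.deleteEdges_adj]; exact ⟨hab, by simpa using he⟩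
        refine absurd ⟨p.concat hab', fun w hw => ?_⟩ hbA
        rw [SimpleGraph.Walk.support_concat] at hw
        simp only [List.mem_append, List.mem_singleton] at hw
        rcases hw with hw | rfl
        · exact hp w hw
        · exact hbS) hxT hyT
  have hyle : degIn G T' y ≤ (T'.filter (· ∈ S)).card := by
    rcases hinv with h | h
    · exact (hmax y hy.1 hyT).trans (h x hxW hxT hxA)
    · exact h y hy.1 hyT ⟨hyA, hyS⟩
  have hbound (z : V) (hz : z ∉ T') (hr : RainbowSet c (insert z S)) :
      (T'.filter (· ∈ S)).card + 1 ≤ (Set.range c).ncard := by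
    rw [← Finset.card_insert_of_notMem (a := z) (by simp [hz])]
    refine Finset.card_le_ncard_range (Set.InjOn.mono ?_ hr)
    intro w hw
    simp only [Finset.coe_insert, Finset.coe_filter, Set.mem_insert_iff, Set.mem_ofPred_eq] at hw ⊢
    tauto
  rcases hrain hadj.symm with h | h
  · have := hbound x hxT h; omega
  · have := hbound y hyT h; omega

theorem sum_degIn_insert {V : Type*} [DecidableEq V] (G : SimpleGraph V) {T : Finset V} {v : V}
    (hv : v ∉ T) :
    ∑ u ∈ insert v T, degIn G (insert v T) u = ∑ u ∈ T, degIn G T u + 2 * degIn G T v := by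
  classical
  have hins (u : V) : degIn G (insert v T) u = degIn G T u + if G.Adj u v then 1 else 0 := by
    convert degIn_insert G hv u
  have hsum : ∑ u ∈ T, (if G.Adj u v then 1 else 0) = degIn G T v := by
    rw [← Finset.card_filter]
    simp only [degIn, G.adj_comm]
  rw [Finset.sum_insert hv]
  simp only [hins, Finset.sum_add_distrib, hsum]
  simp
  ring

/-- A graph with a coloring in `k` colors has at most as many edges as a `k`-degenerate graph. -/
theorem IsRVDColoring.sum_degIn_le {V : Type*} [Finite V] {G : SimpleGraph V} {c : V → ℕ}
    (hc : IsRVDColoring G c) {k : ℕ} (hk : (Set.range c).ncard = k) (j : ℕ) (W : Finset V)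
    (hW : W.card = k + j) : ∑ u ∈ W, degIn G W u ≤ k * (k - 1) + 2 * (k * j) := by
  classical
  induction j generalizing W with
  | zero =>
    calc ∑ u ∈ W, degIn G W u ≤ ∑ u ∈ W, (k - 1) := by
          refine Finset.sum_le_sum fun u hu => ?_
          have : W.filter (fun w => G.Adj u w) ⊆ W.erase u := by
            intro w hw
            rw [Finset.mem_filter] at hw
            exact Finset.mem_erase.2 ⟨hw.2.ne', hw.1⟩
          have h := Finset.card_le_card this
          rw [Finset.card_erase_of_mem hu, hW] at h
          simpa [degIn] using h
      _ ≤ _ := by simp [hW]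
  | succ j ih =>
    obtain ⟨y, hy, hdeg⟩ := hc.exists_degIn_le (W := W) (Finset.card_pos.1 (by omega))
    have hcard : (W.erase y).card = k + j := by rw [Finset.card_erase_of_mem hy]; omega
    have h := sum_degIn_insert G (Finset.notMem_erase y W)
    have hd : degIn G W y = degIn G (W.erase y) y := by
      conv_lhs => rw [← Finset.insert_erase hy]
      convert degIn_insert G (Finset.notMem_erase y W) y using 1
      simp
    rw [Finset.insert_erase hy] at h
    have := ih _ hcard
    rw [h, mul_add k j 1]
    omega

theorem sum_degIn_univ {V : Type*} [Fintype V] (G : SimpleGraph V) :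
    ∑ u, degIn G Finset.univ u = 2 * G.edgeSet.ncard := by
  classical
  have h := G.sum_degrees_eq_twice_card_edges
  rw [← SimpleGraph.coe_edgeFinset, Set.ncard_coe_finset, ← h]
  refine Finset.sum_congr rfl fun u _ => ?_
  rw [← SimpleGraph.card_neighborFinset_eq_degree]
  unfold degIn
  congr 1
  ext w
  simp

theorem IsRVDColoring.ncard_edgeSet_le {n k : ℕ} {G : SimpleGraph (Fin n)} {c : Fin n → ℕ}
    (hc : IsRVDColoring G c) (hk : (Set.range c).ncard = k) (hn : k ≤ n) (hk0 : 1 ≤ k) :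
    G.edgeSet.ncard ≤ k * (n - 1) - k.choose 2 := by
  obtain ⟨j, rfl⟩ := Nat.exists_eq_add_of_le hn
  have h := hc.sum_degIn_le hk j Finset.univ (by simp)
  rw [sum_degIn_univ] at h
  obtain ⟨m, rfl⟩ := Nat.exists_eq_add_of_le' hk0
  have h3 : (m + 1).choose 2 * 2 = (m + 1) * m := by
    rw [Nat.choose_two_right]
    exact Nat.div_two_mul_two_of_even (by simpa [mul_comm] using Nat.even_mul_succ_self m)
  have h4 : (m + 1) * (m + 1 + j - 1) = (m + 1) * m + (m + 1) * j := by
    rw [← mul_add]; congr 1; omega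
  simp only [Nat.add_sub_cancel] at h
  omega

/-- In a clique with at least four vertices all colors are distinct. -/
theorem IsRVDColoring.injOn_of_isClique {V : Type*} {G : SimpleGraph V} {c : V → ℕ}
    (hc : IsRVDColoring G c) {Q : Finset V} (hQ : G.IsClique (Q : Set V)) (h4 : 4 ≤ Q.card) :
    Set.InjOn c Q := by
  classical
  intro u hu v hv huv
  by_contra hne
  have h2 : 1 < (Q \ {u, v}).card := by
    have := Finset.le_card_sdiff {u, v} Q
    have := Finset.card_le_two (a := u) (b := v)
    omega
  obtain ⟨x, hx, y, hy, hxy⟩ := Finset.one_lt_card.1 h2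
  simp only [Finset.mem_sdiff, Finset.mem_insert, Finset.mem_singleton, not_or] at hx hy
  obtain ⟨S, hxS, hyS, hcut, -, hrain⟩ := hc x y hxy
  have hmem (w : V) (hw : w ∈ Q) (hxw : x ≠ w) (hyw : y ≠ w) : w ∈ S := by
    have h1 : (G.deleteEdges {s(x, y)}).Adj x w := by
      rw [SimpleGraph.deleteEdges_adj]
      exact ⟨hQ hx.1 hw hxw, by simp [hyw.symm, hxy]⟩
    have h2 : (G.deleteEdges {s(x, y)}).Adj w y := by
      rw [SimpleGraph.deleteEdges_adj]
      exact ⟨hQ hw hy.1 hyw.symm, by simp [hxw.symm, hyw.symm]⟩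
    obtain ⟨z, hz, hzS⟩ := hcut (.cons h1 (.cons h2 .nil))
    simp only [SimpleGraph.Walk.support_cons, SimpleGraph.Walk.support_nil, List.mem_cons,
      List.not_mem_nil, or_false] at hz
    rcases hz with rfl | rfl | rfl
    · exact absurd hzS hxS
    · exact hzS
    · exact absurd hzS hyS
  have huS := hmem u hu hx.2.1 hy.2.1
  have hvS := hmem v hv hx.2.2 hy.2.2
  rcases hrain (hQ hx.1 hy.1 hxy) with h | h
  · exact hne (h (Set.mem_insert_of_mem _ huS) (Set.mem_insert_of_mem _ hvS) huv)
  · exact hne (h (Set.mem_insert_of_mem _ huS) (Set.mem_insert_of_mem _ hvS) huv)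

/-- The windmill graph on `n` vertices: cliques on `m` vertices (the last one possibly smaller),
all completely joined to the common vertex `0`. -/
def windmill (m n : ℕ) : SimpleGraph (Fin n) where
  Adj i j := i ≠ j ∧ (i.val = 0 ∨ j.val = 0 ∨ (i.val - 1) / m = (j.val - 1) / m)
  symm := ⟨fun i j h => ⟨h.1.symm, by tauto⟩⟩
  loopless := ⟨fun i h => h.1 rfl⟩

/-- The coloring of the windmill graph that numbers the vertices of each blade. -/
def windmillColoring (m n : ℕ) (i : Fin n) : ℕ :=
  if i.val = 0 then 0 else (i.val - 1) % m + 1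

theorem windmillColoring_inj {m n : ℕ} {i j : Fin n}
    (hb : i.val = 0 ∨ j.val = 0 ∨ (i.val - 1) / m = (j.val - 1) / m)
    (h : windmillColoring m n i = windmillColoring m n j) : i = j := by
  unfold windmillColoring at h
  have hi := Nat.div_add_mod (i.val - 1) m
  have hj := Nat.div_add_mod (j.val - 1) m
  ext
  split_ifs at h with h1 h2 h2
  · omega
  · rcases hb with hb | hb | hb
    · omega
    · omega
    · rw [hb] at hi
      omega

theorem windmill_connected (m n : ℕ) (hn : 0 < n) : (windmill m n).Connected := by
  have : Nonempty (Fin n) := ⟨⟨0, hn⟩⟩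
  rw [SimpleGraph.connected_iff_exists_forall_reachable]
  refine ⟨⟨0, hn⟩, fun w => ?_⟩
  by_cases h : (⟨0, hn⟩ : Fin n) = w
  · rw [h]
  · exact SimpleGraph.Adj.reachable ⟨h, Or.inl rfl⟩

theorem windmill_mem_support_of_walk {m n : ℕ} {H : SimpleGraph (Fin n)} (hH : H ≤ windmill m n)
    {i j : Fin n} (p : H.Walk i j) :
    (i.val - 1) / m = (j.val - 1) / m ∨ ∃ v ∈ p.support, v.val = 0 := by
  induction p with
  | nil => exact Or.inl rfl
  | @cons u v w h p ih =>
    rcases (hH h).2 with h0 | h0 | h0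
    · exact Or.inr ⟨u, by simp, h0⟩
    · exact Or.inr ⟨v, by simp, h0⟩
    · rcases ih with ih | ⟨z, hz, hz0⟩
      · exact Or.inl (h0.trans ih)
      · exact Or.inr ⟨z, by simp [hz], hz0⟩

theorem windmill_exists_mem_support_same_blade {m n : ℕ} {H : SimpleGraph (Fin n)}
    (hH : H ≤ windmill m n) {x y : Fin n} (hx : x.val ≠ 0) (hxy : x ≠ y) (hadj : ¬ H.Adj x y)
    (p : H.Walk x y) :
    ∃ v ∈ p.support, (v.val = 0 ∨ (v.val - 1) / m = (x.val - 1) / m) ∧ v ≠ x ∧ v ≠ y := by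
  cases p with
  | nil => exact absurd rfl hxy
  | @cons _ v _ h p =>
    refine ⟨v, by simp, ((hH h).2.resolve_left hx).imp_right Eq.symm, h.ne', ?_⟩
    rintro rfl
    exact hadj h

theorem isRVDColoring_windmill (m n : ℕ) :
    IsRVDColoring (windmill m n) (windmillColoring m n) := by
  intro x y hxy
  by_cases hadj : (windmill m n).Adj x y
  · -- `S` is the rest of a blade containing both vertices
    obtain ⟨b, hbx, hby⟩ : ∃ b, (x.val = 0 ∨ (x.val - 1) / m = b) ∧
        (y.val = 0 ∨ (y.val - 1) / m = b) := by
      rcases hadj.2 with h | h | h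
      · exact ⟨_, Or.inl h, Or.inr rfl⟩
      · exact ⟨_, Or.inr rfl, Or.inl h⟩
      · exact ⟨_, Or.inr h, Or.inr rfl⟩
    refine ⟨{v | (v.val = 0 ∨ (v.val - 1) / m = b) ∧ v ≠ x ∧ v ≠ y}, by simp, by simp, ?_,
      fun h => absurd hadj h, fun _ => Or.inl ?_⟩
    · intro p
      have hH : (windmill m n).deleteEdges {s(x, y)} ≤ windmill m n :=
        SimpleGraph.deleteEdges_le _
      have hx0y0 : x.val ≠ 0 ∨ y.val ≠ 0 := by
        by_contra! h
        exact hxy (Fin.ext (h.1.trans h.2.symm))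
      rcases hx0y0 with h0 | h0
      · obtain ⟨v, hv, hvb, hvx, hvy⟩ :=
          windmill_exists_mem_support_same_blade hH h0 hxy (by simp) p
        exact ⟨v, hv, hbx.resolve_left h0 ▸ hvb, hvx, hvy⟩
      · obtain ⟨v, hv, hvb, hvy, hvx⟩ :=
          windmill_exists_mem_support_same_blade hH h0 hxy.symm (by simp [Sym2.eq_swap]) p.reverse
        exact ⟨v, by simpa using hv, hby.resolve_left h0 ▸ hvb, hvx, hvy⟩
    · intro u hu v hv huv
      have key : ∀ w ∈ insert x {v : Fin n | (v.val = 0 ∨ (v.val - 1) / m = b) ∧ v ≠ x ∧ v ≠ y},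
          w.val = 0 ∨ (w.val - 1) / m = b := by
        rintro w (rfl | hw)
        · exact hbx
        · exact hw.1
      refine windmillColoring_inj ?_ huv
      have h1 := key u hu
      have h2 := key v hv
      rcases h1 with h1 | h1
      · exact Or.inl h1
      · rcases h2 with h2 | h2
        · exact Or.inr (Or.inl h2)
        · exact Or.inr (Or.inr (h1.trans h2.symm))
  · have h0 : x.val ≠ 0 ∧ y.val ≠ 0 ∧ (x.val - 1) / m ≠ (y.val - 1) / m := by
      have : ¬ (x ≠ y ∧ (x.val = 0 ∨ y.val = 0 ∨ (x.val - 1) / m = (y.val - 1) / m)) := hadj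
      tauto
    refine ⟨{v | v.val = 0}, h0.1, h0.2.1, fun p => ?_, fun _ => ?_, fun h => absurd h hadj⟩
    · exact (windmill_mem_support_of_walk (SimpleGraph.deleteEdges_le _) p).resolve_left h0.2.2
    · intro u hu v hv _
      exact Fin.ext (hu.trans hv.symm)

theorem rvd_windmill {m n : ℕ} (hm : 3 ≤ m) (hn : m + 1 ≤ n) : rvd (windmill m n) = m + 1 := by
  have hlower : ∀ c, IsRVDColoring (windmill m n) c → m + 1 ≤ (Set.range c).ncard := by
    intro c hc
    have hcard : (Finset.univ.map (Fin.castLEEmb hn)).card = m + 1 := by simp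
    rw [← hcard]
    refine Finset.card_le_ncard_range (hc.injOn_of_isClique ?_ (by omega))
    intro i hi j hj hij
    refine ⟨hij, ?_⟩
    simp only [Finset.coe_map, Finset.coe_univ, Set.image_univ, Set.mem_range] at hi hj
    obtain ⟨i, rfl⟩ := hi
    obtain ⟨j, rfl⟩ := hj
    have h1 : (i.val - 1) / m = 0 := Nat.div_eq_of_lt (by omega)
    have h2 : (j.val - 1) / m = 0 := Nat.div_eq_of_lt (by omega)
    right; right
    simp [h1, h2]
  have hle : (Set.range (windmillColoring m n)).ncard ≤ m + 1 := by
    have : Set.range (windmillColoring m n) ⊆ (Finset.range (m + 1) : Set ℕ) := by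
      rintro _ ⟨i, rfl⟩
      have := Nat.mod_lt (i.val - 1) (show 0 < m by omega)
      simp only [Finset.coe_range, Set.mem_Iio, windmillColoring]
      split_ifs <;> omega
    simpa using Set.ncard_le_ncard this (Finset.finite_toSet _)
  have hmem : (Set.range (windmillColoring m n)).ncard ∈
      {k | ∃ c, IsRVDColoring (windmill m n) c ∧ (Set.range c).ncard = k} :=
    ⟨_, isRVDColoring_windmill m n, rfl⟩
  refine le_antisymm ((Nat.sInf_le hmem).trans hle) (le_csInf ⟨_, hmem⟩ ?_)
  rintro _ ⟨c, hc, rfl⟩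
  exact hlower c hc

theorem le_degIn_windmill {m n : ℕ} (hm : 0 < m) {i : Fin n} (hi : i.val ≤ (n - 1) / m * m)
    (hi0 : i.val ≠ 0) : m ≤ degIn (windmill m n) Finset.univ i := by
  classical
  set b := (i.val - 1) / m with hb
  have hdm := Nat.div_add_mod (i.val - 1) m
  have hml := Nat.mod_lt (i.val - 1) hm
  have hlt : b < (n - 1) / m := by
    rw [hb, Nat.div_lt_iff_lt_mul hm]; omega
  have hbn : m * b + m ≤ n - 1 := by
    have h1 : (b + 1) * m ≤ (n - 1) / m * m := Nat.mul_le_mul_right m hlt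
    have h2 := Nat.div_mul_le_self (n - 1) m
    nlinarith
  -- the neighbours are the other vertices of the blade and `0`, which replaces `i`
  let e : Fin m → Fin n := fun t =>
    if m * b + 1 + t.val = i.val then ⟨0, by omega⟩ else ⟨m * b + 1 + t.val, by omega⟩
  have he : Function.Injective e := by
    intro s t h
    simp only [e] at h
    ext
    split_ifs at h with h1 h2 h2 <;> simp only [Fin.mk.injEq] at h <;> omega
  calc m = (Finset.univ.image e).card := by rw [Finset.card_image_of_injective _ he]; simp
    _ ≤ _ := by
      refine Finset.card_le_card fun w hw => ?_
      obtain ⟨t, -, rfl⟩ := Finset.mem_image.1 hw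
      simp only [Finset.mem_filter, Finset.mem_univ, true_and, e]
      split_ifs with h
      · exact ⟨fun h => hi0 (by simp [h]), Or.inr (Or.inl rfl)⟩
      · refine ⟨fun h' => h (by simp [h']), Or.inr (Or.inr ?_)⟩
        change (i.val - 1) / m = (m * b + 1 + t.val - 1) / m
        rw [← hb, show m * b + 1 + t.val - 1 = t.val + m * b by omega,
          Nat.add_mul_div_left _ _ hm, Nat.div_eq_of_lt t.isLt, zero_add]

theorem le_ncard_edgeSet_windmill {m n : ℕ} (hm : 0 < m) (hn : 0 < n) :
    (n - 1) / m * (m * (m + 1)) ≤ 2 * (windmill m n).edgeSet.ncard := by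
  classical
  obtain ⟨n, rfl⟩ := Nat.exists_eq_add_of_le' hn
  rw [← sum_degIn_univ, Fin.sum_univ_succ]
  simp only [Nat.add_sub_cancel]
  have hqn := Nat.div_mul_le_self n m
  have h0 : n ≤ degIn (windmill m (n + 1)) Finset.univ 0 := by
    calc n = (Finset.univ.erase (0 : Fin (n + 1))).card := by simp
      _ ≤ _ := by
        refine Finset.card_le_card fun w hw => ?_
        simp only [Finset.mem_filter, Finset.mem_univ, true_and]
        exact show (windmill m (n + 1)).Adj 0 w from
          ⟨(Finset.ne_of_mem_erase hw).symm, Or.inl rfl⟩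
  have h1 : n / m * m * m ≤
      ∑ i : Fin n, degIn (windmill m (n + 1)) Finset.univ i.succ := by
    calc n / m * m * m = ∑ i ∈ Finset.univ.map (Fin.castLEEmb hqn), m := by simp
      _ ≤ ∑ i ∈ Finset.univ.map (Fin.castLEEmb hqn),
          degIn (windmill m (n + 1)) Finset.univ i.succ := by
        refine Finset.sum_le_sum fun i hi => ?_
        obtain ⟨j, -, rfl⟩ := Finset.mem_map.1 hi
        exact le_degIn_windmill hm (by simp) (by simp)
      _ ≤ _ := Finset.sum_le_sum_of_subset (Finset.subset_univ _)
  nlinarith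

/-- For `k ≥ 4` and `n ≥ k`: every connected graph `G` of order `n` with `rvd G = k`
has at most `k(n-1) - C(k,2)` edges, and there is a connected graph of order `n` with
`rvd = k` and at least `k(n-1)/2 - C(k,2)` edges. -/
theorem stmt19 (k n : ℕ) (hk : 4 ≤ k) (hn : k ≤ n) :
    (∀ G : SimpleGraph (Fin n), G.Connected → rvd G = k →
      G.edgeSet.ncard ≤ k * (n - 1) - k.choose 2) ∧
    (∃ G : SimpleGraph (Fin n), G.Connected ∧ rvd G = k ∧
      (k : ℚ) * ((n : ℚ) - 1) / 2 - (k.choose 2 : ℚ) ≤ (G.edgeSet.ncard : ℚ)) := by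
  refine ⟨fun G _ hG => ?_, windmill (k - 1) n, windmill_connected _ _ (by omega), ?_, ?_⟩
  · have hne : {k | ∃ c : Fin n → ℕ, IsRVDColoring G c ∧ (Set.range c).ncard = k}.Nonempty := by
      refine Nat.nonempty_of_pos_sInf ?_
      change 0 < rvd G
      omega
    obtain ⟨c, hc, hck⟩ := Nat.sInf_mem hne
    exact hc.ncard_edgeSet_le (hck.trans hG) hn (by omega)
  · rw [rvd_windmill (by omega) (by omega)]
    omega
  · obtain ⟨m, rfl⟩ := Nat.exists_eq_add_of_le' (show 1 ≤ k by omega)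
    obtain ⟨l, rfl⟩ := Nat.exists_eq_add_of_le' (show 1 ≤ n by omega)
    have hm : 0 < m := by omega
    have h := le_ncard_edgeSet_windmill (m := m) (n := l + 1) hm (by omega)
    simp only [Nat.add_sub_cancel] at h ⊢
    have hdm := Nat.div_add_mod l m
    have hml := Nat.mod_lt l hm
    have h' : (l + 1 - 1 : ℕ) / m * (m * (m + 1)) + m * (m + 1) ≥ (m + 1) * l := by
      simp only [Nat.add_sub_cancel]
      nlinarith
    simp only [Nat.add_sub_cancel] at h'
    have h2 : (m + 1) * l ≤ 2 * (windmill m (l + 1)).edgeSet.ncard + m * (m + 1) := by omega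
    have h3 : ((m : ℚ) + 1) * l ≤ 2 * ((windmill m (l + 1)).edgeSet.ncard : ℚ) + m * (m + 1) := by
      exact_mod_cast h2
    rw [Nat.cast_choose_two]
    push_cast
    linarith
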